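/- Let m > n > p > q > 0, ρ₁, ρ₂ ∈ ℝ, T > 0, and let w : [0,T] → ℝ be continuous. Set D₁ = ((m−n)/(1+m))·((1+m)/(1+n))^{(1+n)/(m−n)} and D₂ = ((p−q)/(1+p))·((1+p)/(1+q))^{(1+q)/(p−q)}. Let h₁, h₂ : [0,T] → ℝ be differentiable with h₁(t), h₂(t) > 0 for all t, satisfying h₁′(t) = e^{ρ₁ w(t)}·(h₁(t)^{1+m} + h₂(t)^{1+n}) and h₂′(t) = e^{ρ₂ w(t)}·(h₁(t)^{1+p} + h₂(t)^{1+q}) on [0,T]. Let E(0) = h₁(0) + h₂(0) ≥ 1 and ε₀ = min{1, (h₁(0)/D₁^{1/(1+n)})^{m−n}, (2^{−(1+n)}·E(0)^{1+n}/D₁)^{(m−n)/(1+m)}, (h₁(0)/D₂^{1/(1+q)})^{p−q}, (2^{−(1+q)}·E(0)^{1+q}/D₂)^{(p−q)/(1+p)}}. Assume 2^{−(1+n)}·ε₀·E(0)^{1+n} ≥ ε₀^{(1+m)/(m−n)}·D₁, 2^{−(1+q)}·ε₀·E(0)^{1+q} ≥ ε₀^{(1+p)/(p−q)}·D₂, and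 2^{−n}·ε₀·E(0)^{1+q} > ε₀^{(1+m)/(m−n)}·D₁ + ε₀^{(1+p)/(p−q)}·D₂. Then ∫₀ᵀ min(e^{ρ₁ w(s)}, e^{ρ₂ w(s)}) ds < [q·E(0)^{q}·(ε₀·2^{−n} − (ε₀^{(1+m)/(m−n)}·D₁ + ε₀^{(1+p)/(p−q)}·D₂)·E(0)^{−(1+q)})]^{−1}. -/

import Mathlib

open intervalIntegral Set Real

/-- The constant produced by Young's inequality is at least the sharp one. -/
lemma young_constant_ge {m n : ℝ} (hn : 0 < n) (hmn : n < m) :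
    (m - n) / (1 + m) ≤ ((m - n) / (1 + m)) * ((1 + m) / (1 + n)) ^ ((1 + n) / (m - n)) := by
  have hd : 0 < m - n := sub_pos.2 hmn
  have hm : 0 < 1 + m := by linarith
  have hr : 1 ≤ (1 + m) / (1 + n) := by
    rw [le_div_iff₀ (by linarith)]
    linarith
  exact le_mul_of_one_le_right (by positivity) (one_le_rpow hr (by positivity))

/-- Weighted Young inequality comparing two powers of a positive number. -/
lemma mul_rpow_le_rpow_add {m n x ε D : ℝ} (hn : 0 < n) (hmn : n < m) (hx : 0 < x) (hε : 0 < ε)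
    (hD : (m - n) / (1 + m) ≤ D) :
    ε * x ^ (1 + n) ≤ x ^ (1 + m) + ε ^ ((1 + m) / (m - n)) * D := by
  have hd : 0 < m - n := sub_pos.2 hmn
  have hn1 : 0 < 1 + n := by linarith
  have hm : 0 < 1 + m := by linarith
  have hr : 1 < (1 + m) / (1 + n) := by
    rw [lt_div_iff₀ hn1]
    linarith
  have hconj : ((1 + m) / (1 + n)).HolderConjugate ((1 + m) / (m - n)) := by
    rw [Real.holderConjugate_iff]
    refine ⟨hr, ?_⟩
    field_simp
    ring
  have hy := Real.young_inequality_of_nonneg (a := x ^ (1 + n)) (b := ε) (by positivity) hε.le hconj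
  rw [← rpow_mul hx.le, mul_div_cancel₀ _ hn1.ne'] at hy
  have h1 : x ^ (1 + m) / ((1 + m) / (1 + n)) ≤ x ^ (1 + m) := div_le_self (by positivity) hr.le
  have h2 : ε ^ ((1 + m) / (m - n)) / ((1 + m) / (m - n)) ≤ ε ^ ((1 + m) / (m - n)) * D := by
    rw [div_eq_mul_inv, inv_div]
    gcongr
  linarith

/-- Convexity of `x ↦ x ^ (1 + r)` at the midpoint. -/
lemma two_rpow_neg_mul_add_rpow_le {r x y : ℝ} (hr : 0 < r) (hx : 0 < x) (hy : 0 < y) :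
    2 ^ (-r) * (x + y) ^ (1 + r) ≤ x ^ (1 + r) + y ^ (1 + r) := by
  have h := (convexOn_rpow (p := 1 + r) (by linarith)).2 (mem_Ici.2 hx.le) (mem_Ici.2 hy.le)
    one_half_pos.le one_half_pos.le (add_halves 1)
  simp only [smul_eq_mul] at h
  rw [← mul_add, ← mul_add, mul_rpow (by norm_num) (by positivity), one_div,
    inv_rpow zero_le_two, ← rpow_neg zero_le_two, neg_add, rpow_add two_pos, rpow_neg_one] at h
  linarith

/-- Lower bound for the sum of the two nonlinearities by a pure power of `x + y`. -/
lemma sum_rpow_ge {m n p q x y ε D₁ D₂ E₀ : ℝ} (hq : 0 < q) (hpq : q < p) (hnp : p < n)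
    (hmn : n < m) (hx : 0 < x) (hy : 0 < y) (hε : 0 < ε) (hε1 : ε ≤ 1)
    (hD₁ : (m - n) / (1 + m) ≤ D₁) (hD₂ : (p - q) / (1 + p) ≤ D₂)
    (hE₀ : 1 ≤ E₀) (hE : E₀ ≤ x + y) :
    (ε * 2 ^ (-n) - (ε ^ ((1 + m) / (m - n)) * D₁ + ε ^ ((1 + p) / (p - q)) * D₂)
      * E₀ ^ (-(1 + q))) * (x + y) ^ (1 + q)
      ≤ (x ^ (1 + m) + y ^ (1 + n)) + (x ^ (1 + p) + y ^ (1 + q)) := by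
  have hn : 0 < n := by linarith
  have hdm : 0 < m - n := sub_pos.2 hmn
  have hdp : 0 < p - q := sub_pos.2 hpq
  have hm1 : 0 < 1 + m := by linarith
  have hp1 : 0 < 1 + p := by linarith
  have hD₁0 : 0 ≤ D₁ := le_trans (by positivity) hD₁
  have hD₂0 : 0 ≤ D₂ := le_trans (by positivity) hD₂
  have hE0 : 0 < E₀ := by linarith
  have y1 := mul_rpow_le_rpow_add hn hmn hx hε hD₁
  have y2 := mul_rpow_le_rpow_add hq hpq hx hε hD₂
  have c1 := mul_le_mul_of_nonneg_left (two_rpow_neg_mul_add_rpow_le hn hx hy) hε.le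
  have e1 : ε * y ^ (1 + n) ≤ y ^ (1 + n) := mul_le_of_le_one_left (by positivity) hε1
  have e2 : 0 < ε * x ^ (1 + q) := by positivity
  have e3 : 0 < y ^ (1 + q) := by positivity
  have pw : (x + y) ^ (1 + q) ≤ (x + y) ^ (1 + n) :=
    rpow_le_rpow_of_exponent_le (by linarith) (by linarith)
  have hc : (0 : ℝ) ≤ ε * 2 ^ (-n) := by positivity
  have pw' := mul_le_mul_of_nonneg_left pw hc
  set C := ε ^ ((1 + m) / (m - n)) * D₁ + ε ^ ((1 + p) / (p - q)) * D₂ with hC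
  have hC0 : 0 ≤ C := by positivity
  have one_le : 1 ≤ E₀ ^ (-(1 + q)) * (x + y) ^ (1 + q) := by
    rw [rpow_neg hE0.le, inv_mul_eq_div, one_le_div (by positivity)]
    exact rpow_le_rpow hE0.le hE (by linarith)
  have := mul_le_mul_of_nonneg_left one_le hC0
  nlinarith

/-- A solution of `E' ≥ K a E ^ (1 + q)` starting at a positive value and existing on `[0, T]`
bounds the integral of `a`. -/
lemma integral_lt_of_deriv_ge_rpow {T q K : ℝ} (hT : 0 ≤ T) (hq : 0 < q) (hK : 0 < K)
    {a E E' : ℝ → ℝ} (ha : ContinuousOn a (Icc 0 T)) (hE : ∀ t ∈ Icc (0 : ℝ) T, 0 < E t)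
    (hE' : ∀ t ∈ Icc (0 : ℝ) T, HasDerivWithinAt E (E' t) (Icc 0 T) t)
    (hle : ∀ t ∈ Icc (0 : ℝ) T, a t * (K * E t ^ (1 + q)) ≤ E' t) :
    ∫ s in (0 : ℝ)..T, a s < (q * E 0 ^ q * K)⁻¹ := by
  have h0 : (0 : ℝ) ∈ Icc 0 T := ⟨le_rfl, hT⟩
  have hTT : T ∈ Icc 0 T := ⟨hT, le_rfl⟩
  have hcont : ContinuousOn E (Icc 0 T) := fun t ht => (hE' t ht).continuousWithinAt
  have key : ∫ s in (0 : ℝ)..T, q * K * a s ≤ -(E T) ^ (-q) - -(E 0) ^ (-q) := by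
    refine intervalIntegral.integral_le_sub_of_hasDeriv_right_of_le
      (g := fun t => -(E t) ^ (-q)) (g' := fun t => -(E' t * (-q) * E t ^ (-q - 1))) hT
      (hcont.rpow_const fun t ht => Or.inl (hE t ht).ne').neg ?_
      (ContinuousOn.integrableOn_Icc (continuousOn_const.mul ha)) ?_
    · intro t ht
      have ht' := Ioo_subset_Icc_self ht
      exact (((hE' t ht').hasDerivAt (Icc_mem_nhds ht.1 ht.2)).rpow_const
        (Or.inl (hE t ht').ne')).neg.hasDerivWithinAt
    · intro t ht
      have ht' := Ioo_subset_Icc_self ht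
      have hp := hE t ht'
      have hmul : E t ^ (1 + q) * E t ^ (-q - 1) = 1 := by
        rw [← rpow_add hp]
        ring_nf
        exact rpow_zero _
      have hx := mul_le_mul_of_nonneg_left (hle t ht')
        (by positivity : (0 : ℝ) ≤ q * E t ^ (-q - 1))
      calc q * K * a t = q * K * a t * (E t ^ (1 + q) * E t ^ (-q - 1)) := by rw [hmul, mul_one]
        _ = q * E t ^ (-q - 1) * (a t * (K * E t ^ (1 + q))) := by ring
        _ ≤ q * E t ^ (-q - 1) * E' t := hx
        _ = -(E' t * (-q) * E t ^ (-q - 1)) := by ring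
  rw [intervalIntegral.integral_const_mul] at key
  have hT0 := hE T hTT
  have h00 := hE 0 h0
  have hpos : 0 < E T ^ (-q) := by positivity
  have hinv : (q * E 0 ^ q * K)⁻¹ = E 0 ^ (-q) / (q * K) := by
    rw [rpow_neg h00.le]
    field_simp
  rw [hinv, lt_div_iff₀ (by positivity)]
  linarith

/-- Pathwise content of Theorem 4.1, Case 3 (`m > n > p > q > 0`):
a positive solution of the comparison system (4.2) on `[0,T]` forces the integral of
`min(e^{ρ₁ w}, e^{ρ₂ w})` to stay below the stated threshold. -/
theorem stmt_8 (m n p q ρ₁ ρ₂ T : ℝ) (hq : 0 < q) (hpq : q < p) (hnp : p < n) (hmn : n < m)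
    (hT : 0 < T)
    (w : ℝ → ℝ) (hw : ContinuousOn w (Icc 0 T))
    (D₁ : ℝ) (hD₁ : D₁ = ((m - n) / (1 + m)) * ((1 + m) / (1 + n)) ^ ((1 + n) / (m - n)))
    (D₂ : ℝ) (hD₂ : D₂ = ((p - q) / (1 + p)) * ((1 + p) / (1 + q)) ^ ((1 + q) / (p - q)))
    (h₁ h₂ : ℝ → ℝ)
    (h₁_pos : ∀ t ∈ Icc (0 : ℝ) T, 0 < h₁ t) (h₂_pos : ∀ t ∈ Icc (0 : ℝ) T, 0 < h₂ t)
    (h₁_deriv : ∀ t ∈ Icc (0 : ℝ) T,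
      HasDerivWithinAt h₁ (Real.exp (ρ₁ * w t) * (h₁ t ^ (1 + m) + h₂ t ^ (1 + n))) (Icc 0 T) t)
    (h₂_deriv : ∀ t ∈ Icc (0 : ℝ) T,
      HasDerivWithinAt h₂ (Real.exp (ρ₂ * w t) * (h₁ t ^ (1 + p) + h₂ t ^ (1 + q))) (Icc 0 T) t)
    (E₀ : ℝ) (hE₀ : E₀ = h₁ 0 + h₂ 0) (hE₀_ge : 1 ≤ E₀)
    (ε₀ : ℝ)
    (hε₀ : ε₀ = min 1 (min ((h₁ 0 / D₁ ^ ((1 : ℝ) / (1 + n))) ^ (m - n))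
      (min ((2 ^ (-(1 + n)) * E₀ ^ (1 + n) / D₁) ^ ((m - n) / (1 + m)))
      (min ((h₁ 0 / D₂ ^ ((1 : ℝ) / (1 + q))) ^ (p - q))
        ((2 ^ (-(1 + q)) * E₀ ^ (1 + q) / D₂) ^ ((p - q) / (1 + p)))))))
    (hcond₁ : ε₀ ^ ((1 + m) / (m - n)) * D₁ ≤ 2 ^ (-(1 + n)) * ε₀ * E₀ ^ (1 + n))
    (hcond₂ : ε₀ ^ ((1 + p) / (p - q)) * D₂ ≤ 2 ^ (-(1 + q)) * ε₀ * E₀ ^ (1 + q))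
    (hcond₃ : ε₀ ^ ((1 + m) / (m - n)) * D₁ + ε₀ ^ ((1 + p) / (p - q)) * D₂
      < 2 ^ (-n) * ε₀ * E₀ ^ (1 + q)) :
    ∫ s in (0 : ℝ)..T, min (Real.exp (ρ₁ * w s)) (Real.exp (ρ₂ * w s))
      < (q * E₀ ^ q * (ε₀ * 2 ^ (-n)
          - (ε₀ ^ ((1 + m) / (m - n)) * D₁ + ε₀ ^ ((1 + p) / (p - q)) * D₂) * E₀ ^ (-(1 + q))))⁻¹ := by
  have hd₁ : 0 < m - n := sub_pos.2 hmn
  have hd₂ : 0 < p - q := sub_pos.2 hpq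
  have hn : 0 < n := by linarith
  have hm1 : 0 < 1 + m := by linarith
  have hn1 : 0 < 1 + n := by linarith
  have hp1 : 0 < 1 + p := by linarith
  have hD₁' : (m - n) / (1 + m) ≤ D₁ := hD₁ ▸ young_constant_ge hn hmn
  have hD₂' : (p - q) / (1 + p) ≤ D₂ := hD₂ ▸ young_constant_ge hq hpq
  have hD₁0 : 0 < D₁ := lt_of_lt_of_le (by positivity) hD₁'
  have hD₂0 : 0 < D₂ := lt_of_lt_of_le (by positivity) hD₂'
  have hE₀0 : 0 < E₀ := by linarith
  have h0 : (0 : ℝ) ∈ Icc 0 T := ⟨le_rfl, hT.le⟩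
  have h₁0 := h₁_pos 0 h0
  have hε : 0 < ε₀ := by
    rw [hε₀]
    refine lt_min one_pos (lt_min ?_ (lt_min ?_ (lt_min ?_ ?_))) <;> positivity
  have hε1 : ε₀ ≤ 1 := hε₀ ▸ min_le_left _ _
  have hK : 0 < ε₀ * 2 ^ (-n)
      - (ε₀ ^ ((1 + m) / (m - n)) * D₁ + ε₀ ^ ((1 + p) / (p - q)) * D₂) * E₀ ^ (-(1 + q)) := by
    rw [sub_pos, rpow_neg hE₀0.le, ← div_eq_mul_inv, div_lt_iff₀ (by positivity)]
    linarith
  have hderiv : ∀ t ∈ Icc (0 : ℝ) T, HasDerivWithinAt (fun t => h₁ t + h₂ t)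
      (Real.exp (ρ₁ * w t) * (h₁ t ^ (1 + m) + h₂ t ^ (1 + n))
        + Real.exp (ρ₂ * w t) * (h₁ t ^ (1 + p) + h₂ t ^ (1 + q))) (Icc 0 T) t :=
    fun t ht => (h₁_deriv t ht).add (h₂_deriv t ht)
  have hmono : MonotoneOn (fun t => h₁ t + h₂ t) (Icc 0 T) := by
    refine monotoneOn_of_hasDerivWithinAt_nonneg (convex_Icc 0 T)
      (fun t ht => (hderiv t ht).continuousWithinAt)
      (fun t ht => (hderiv t (interior_subset ht)).mono interior_subset) fun t ht => ?_
    have a := h₁_pos t (interior_subset ht)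
    have b := h₂_pos t (interior_subset ht)
    positivity
  have hmin : ContinuousOn (fun s => min (Real.exp (ρ₁ * w s)) (Real.exp (ρ₂ * w s))) (Icc 0 T) := by
    fun_prop
  have hmain := integral_lt_of_deriv_ge_rpow (a := fun s => min (Real.exp (ρ₁ * w s))
    (Real.exp (ρ₂ * w s))) hT.le hq hK hmin
    (fun t ht => add_pos (h₁_pos t ht) (h₂_pos t ht)) hderiv fun t ht => ?_
  · rw [← hE₀] at hmain
    exact hmain
  · have a := h₁_pos t ht
    have b := h₂_pos t ht
    have hs := sum_rpow_ge hq hpq hnp hmn a b hε hε1 hD₁' hD₂' hE₀_ge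
      (hE₀.trans_le (hmono h0 ht ht.1))
    refine (mul_le_mul_of_nonneg_left hs (by positivity)).trans ?_
    rw [mul_add]
    gcongr
    · exact min_le_left _ _
    · exact min_le_right _ _
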